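/- arXiv:2212.04327 — 2 statements merged into one kernel-verified Lean document; each statement's English description precedes it below -/
import Mathlib

section
/- For every RIM quantifier Λ and all fuzzy sets A, B on X, F_owa(Q^→_Λ)(A,B) equals the Choquet integral of I_KD(A,B) with respect to the monotone measure μ_Λ(S) = Λ(|S|/n), i.e., F_owa(Q^→_Λ)(A,B) = Ỹ^{I_KD}_Λ(A,B). -/
attribute [local instance] Classical.propDecidable

/-- A fuzzy set on `X` is a function `X → [0,1]`. -/
def IsFuzzySet {X : Type*} (A : X → ℝ) : Prop := ∀ x, A x ∈ Set.Icc (0:ℝ) 1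

/-- A RIM quantifier: nondecreasing on `[0,1]`, `Λ 0 = 0`, `Λ 1 = 1`. -/
def IsRIM (Λ : ℝ → ℝ) : Prop :=
  MonotoneOn Λ (Set.Icc 0 1) ∧ Λ 0 = 0 ∧ Λ 1 = 1

/-- An implicator `I : [0,1]² → [0,1]`. -/
def IsImplicator (I : ℝ → ℝ → ℝ) : Prop :=
  (∀ x ∈ Set.Icc (0:ℝ) 1, ∀ y ∈ Set.Icc (0:ℝ) 1, I x y ∈ Set.Icc (0:ℝ) 1) ∧
  I 0 0 = 1 ∧ I 0 1 = 1 ∧ I 1 1 = 1 ∧ I 1 0 = 0 ∧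
  (∀ y ∈ Set.Icc (0:ℝ) 1, AntitoneOn (fun x => I x y) (Set.Icc 0 1)) ∧
  (∀ x ∈ Set.Icc (0:ℝ) 1, MonotoneOn (fun y => I x y) (Set.Icc 0 1))

/-- A monotone measure on the finite set `X`. -/
def IsMonotoneMeasure {X : Type*} [Fintype X] (μ : Finset X → ℝ) : Prop :=
  μ ∅ = 0 ∧ μ Finset.univ = 1 ∧ ∀ ⦃S T : Finset X⦄, S ⊆ T → μ S ≤ μ T

/-- The (discrete) Choquet integral of `f` w.r.t. `μ`:
`∑ᵢ f(x*ᵢ) (μ(A*ᵢ) − μ(A*ᵢ₊₁))` where `x*₁,…,x*ₙ` enumerates `X` with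
`f(x*₁) ≤ … ≤ f(x*ₙ)` and `A*ᵢ = {x*ᵢ,…,x*ₙ}`. -/
noncomputable def choquet {X : Type*} [Fintype X] [Nonempty X]
    (μ : Finset X → ℝ) (f : X → ℝ) : ℝ :=
  let l := Finset.univ.toList.mergeSort (fun a b : X => decide (f a ≤ f b))
  ∑ i ∈ Finset.range l.length,
    f (l.getD i (Classical.arbitrary X)) *
      (μ (l.drop i).toFinset - μ (l.drop (i + 1)).toFinset)

/-- The measure `μ_Λ(S) = Λ(|S|/n)`. -/
noncomputable def muLambda {X : Type*} [Fintype X] (Λ : ℝ → ℝ) (S : Finset X) : ℝ :=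
  Λ ((S.card : ℝ) / (Fintype.card X : ℝ))

/-- The measure `μ^A_Λ(S) = Λ(∑_{x∈S} A(x) / |A|_Σ)`. -/
noncomputable def muWeighted {X : Type*} [Fintype X] (Λ : ℝ → ℝ) (A : X → ℝ) (S : Finset X) : ℝ :=
  Λ ((∑ x ∈ S, A x) / ∑ x, A x)

/-- The measure `μ'_Λ(S) = Λ((∑_{j=1}^{|S|} a₍ⱼ₎)/|A|_Σ)`, with `a₍₁₎ ≤ … ≤ a₍ₙ₎`
the values of `A` in nondecreasing order. -/
noncomputable def muPrime {X : Type*} [Fintype X] (Λ : ℝ → ℝ) (A : X → ℝ) (S : Finset X) : ℝ :=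
  Λ ((((Finset.univ.toList.map A).mergeSort (fun a b : ℝ => decide (a ≤ b))).take S.card).sum
      / ∑ x, A x)

/-- The lower bound `A^min_γ` of the three-valued cut of `A` at `γ`. -/
noncomputable def cutMin {X : Type*} [Fintype X] (A : X → ℝ) (γ : ℝ) : Finset X :=
  if 0 < γ then Finset.univ.filter (fun x => (1 + γ) / 2 ≤ A x)
  else Finset.univ.filter (fun x => 1 / 2 < A x)

/-- The upper bound `A^max_γ` of the three-valued cut of `A` at `γ`. -/
noncomputable def cutMax {X : Type*} [Fintype X] (A : X → ℝ) (γ : ℝ) : Finset X :=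
  if 0 < γ then Finset.univ.filter (fun x => (1 - γ) / 2 < A x)
  else Finset.univ.filter (fun x => 1 / 2 ≤ A x)

/-- `F_owa` applied to a unary semi-fuzzy quantifier `Q`:
`∫₀¹ (⊤(γ) + ⊥(γ))/2 dγ` where `⊤(γ)`/`⊥(γ)` are the max/min of `Q(B)` over
`A^min_γ ⊆ B ⊆ A^max_γ`. -/
noncomputable def Fowa1 {X : Type*} [Fintype X] (Q : Finset X → ℝ) (A : X → ℝ) : ℝ :=
  ∫ γ in (0:ℝ)..1,
    (sSup {r : ℝ | ∃ B : Finset X, cutMin A γ ⊆ B ∧ B ⊆ cutMax A γ ∧ Q B = r} +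
     sInf {r : ℝ | ∃ B : Finset X, cutMin A γ ⊆ B ∧ B ⊆ cutMax A γ ∧ Q B = r}) / 2

/-- `F_owa` applied to a binary semi-fuzzy quantifier `Q`. -/
noncomputable def Fowa2 {X : Type*} [Fintype X]
    (Q : Finset X → Finset X → ℝ) (A B : X → ℝ) : ℝ :=
  ∫ γ in (0:ℝ)..1,
    (sSup {r : ℝ | ∃ S T : Finset X, cutMin A γ ⊆ S ∧ S ⊆ cutMax A γ ∧
        cutMin B γ ⊆ T ∧ T ⊆ cutMax B γ ∧ Q S T = r} +
     sInf {r : ℝ | ∃ S T : Finset X, cutMin A γ ⊆ S ∧ S ⊆ cutMax A γ ∧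
        cutMin B γ ⊆ T ∧ T ⊆ cutMax B γ ∧ Q S T = r}) / 2

theorem aux_list_sum {X : Type*} (μ : Finset X → ℝ) (f : X → ℝ) (d : X) (p : X → Prop)
    (hp : ∀ x y, p x → f x ≤ f y → p y) (l : List X)
    (hl : l.Pairwise (fun a b => f a ≤ f b)) :
    ∑ i ∈ Finset.range l.length, (if p (l.getD i d) then (1:ℝ) else 0) *
      (μ (l.drop i).toFinset - μ (l.drop (i + 1)).toFinset) =
    μ (l.toFinset.filter p) - μ ∅ := by
  induction l with
  | nil => simp
  | cons a l ih =>
    rw [List.pairwise_cons] at hl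
    rw [List.length_cons, Finset.sum_range_succ']
    simp only [List.getD_cons_succ, List.getD_cons_zero, List.drop_succ_cons, List.drop_zero]
    rw [ih hl.2]
    by_cases ha : p a
    · have h1 : l.toFinset.filter p = l.toFinset := by
        apply Finset.filter_true_of_mem
        intro x hx
        exact hp a x ha (hl.1 x (by simpa using hx))
      have h2 : (a :: l).toFinset.filter p = (a :: l).toFinset := by
        apply Finset.filter_true_of_mem
        intro x hx
        rcases List.mem_cons.1 (List.mem_toFinset.1 hx) with h | h
        · exact h ▸ ha
        · exact hp a x ha (hl.1 x h)
      rw [h1, h2, if_pos ha]; ring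
    · have h2 : (a :: l).toFinset.filter p = l.toFinset.filter p := by
        rw [List.toFinset_cons, Finset.filter_insert, if_neg ha]
      rw [h2, if_neg ha]; ring

theorem aux_int1 (c : ℝ) : IntervalIntegrable
    (fun γ : ℝ => if (1 - γ) / 2 < c then (1:ℝ) else 0) MeasureTheory.volume 0 1 := by
  apply Monotone.intervalIntegrable
  intro a b hab
  dsimp only
  split_ifs <;> first | linarith | norm_num

theorem aux_int2 (c : ℝ) : IntervalIntegrable
    (fun γ : ℝ => if (1 + γ) / 2 ≤ c then (1:ℝ) else 0) MeasureTheory.volume 0 1 := by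
  apply Antitone.intervalIntegrable
  intro a b hab
  dsimp only
  split_ifs <;> first | linarith | norm_num

theorem aux_val1 (c : ℝ) :
    ∫ γ in (0:ℝ)..1, (if (1 - γ) / 2 < c then (1:ℝ) else 0) = max (1 - max 0 (1 - 2 * c)) 0 := by
  have h : (fun γ : ℝ => if (1 - γ) / 2 < c then (1:ℝ) else 0) =
      (Set.Ioi (1 - 2 * c)).indicator (fun _ => (1:ℝ)) := by
    funext γ
    have : (1 - γ) / 2 < c ↔ 1 - 2 * c < γ := by constructor <;> intro h <;> linarith
    simp [Set.indicator, this]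
  rw [h, intervalIntegral.integral_of_le zero_le_one,
    MeasureTheory.setIntegral_indicator measurableSet_Ioi, Set.Ioc_inter_Ioi]
  simp [Real.volume_real_Ioc]

theorem aux_val2 (c : ℝ) :
    ∫ γ in (0:ℝ)..1, (if (1 + γ) / 2 ≤ c then (1:ℝ) else 0) = max (min 1 (2 * c - 1)) 0 := by
  have h : (fun γ : ℝ => if (1 + γ) / 2 ≤ c then (1:ℝ) else 0) =
      (Set.Iic (2 * c - 1)).indicator (fun _ => (1:ℝ)) := by
    funext γ
    have : (1 + γ) / 2 ≤ c ↔ γ ≤ 2 * c - 1 := by constructor <;> intro h <;> linarith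
    simp [Set.indicator, this]
  rw [h, intervalIntegral.integral_of_le zero_le_one,
    MeasureTheory.setIntegral_indicator measurableSet_Iic, Set.Ioc_inter_Iic]
  simp [Real.volume_real_Ioc]

theorem aux_val (c : ℝ) (hc : c ∈ Set.Icc (0:ℝ) 1) :
    ∫ γ in (0:ℝ)..1, ((if (1 - γ) / 2 < c then (1:ℝ) else 0) +
      (if (1 + γ) / 2 ≤ c then (1:ℝ) else 0)) = 2 * c := by
  rw [intervalIntegral.integral_add (aux_int1 c) (aux_int2 c), aux_val1, aux_val2]
  obtain ⟨h0, h1⟩ := hc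
  rcases le_total c (1/2) with h | h
  · rw [max_eq_right (by linarith : (0:ℝ) ≤ 1 - 2 * c), max_eq_left (by linarith),
      min_eq_right (by linarith), max_eq_right (by linarith)]
    ring
  · rw [max_eq_left (by linarith : 1 - 2 * c ≤ (0:ℝ)), max_eq_left (by linarith),
      min_eq_right (by linarith), max_eq_left (by linarith)]
    ring

theorem aux_card {X : Type*} [Fintype X] (S T : Finset X) :
    (((Finset.univ \ S).card : ℝ) + ((S ∩ T).card : ℝ)) =
      ((Finset.univ.filter (fun x => x ∉ S ∨ x ∈ T)).card : ℝ) := by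
  have : Finset.univ.filter (fun x => x ∉ S ∨ x ∈ T) = (Finset.univ \ S) ∪ (S ∩ T) := by
    ext x
    simp only [Finset.mem_filter, Finset.mem_univ, true_and, Finset.mem_union, Finset.mem_sdiff,
      Finset.mem_inter]
    tauto
  rw [this, Finset.card_union_of_disjoint]
  · push_cast; rfl
  · rw [Finset.disjoint_left]
    intro x hx hx'
    simp only [Finset.mem_univ, true_and, Finset.mem_sdiff, Finset.mem_inter] at hx hx'
    exact hx hx'.1

theorem aux_mono {X : Type*} [Fintype X] [Nonempty X] {Λ : ℝ → ℝ} (hΛ : IsRIM Λ)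
    {S T : Finset X} (h : S ⊆ T) : muLambda Λ S ≤ muLambda Λ T := by
  have hn : (0:ℝ) < Fintype.card X := by exact_mod_cast Fintype.card_pos
  have hm : ∀ U : Finset X, (U.card : ℝ) / (Fintype.card X : ℝ) ∈ Set.Icc (0:ℝ) 1 := by
    intro U
    refine ⟨by positivity, ?_⟩
    rw [div_le_one hn]
    exact_mod_cast Finset.card_le_univ U
  apply hΛ.1 (hm S) (hm T)
  have := Finset.card_le_card h
  gcongr

theorem aux_cut {X : Type*} [Fintype X] (A : X → ℝ) (γ : ℝ) (hγ : 0 < γ) :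
    cutMin A γ ⊆ cutMax A γ := by
  intro x
  simp only [cutMin, cutMax, if_pos hγ, Finset.mem_filter, Finset.mem_univ, true_and]
  intro h
  linarith

theorem aux_sup {X : Type*} [Fintype X] [Nonempty X]
    (Λ : ℝ → ℝ) (hΛ : IsRIM Λ) (A B : X → ℝ) (γ : ℝ) (hγ : 0 < γ) :
    IsGreatest {r : ℝ | ∃ S T : Finset X, cutMin A γ ⊆ S ∧ S ⊆ cutMax A γ ∧
        cutMin B γ ⊆ T ∧ T ⊆ cutMax B γ ∧
        Λ ((((Finset.univ \ S).card : ℝ) + ((S ∩ T).card : ℝ)) / (Fintype.card X : ℝ)) = r}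
      (muLambda Λ (Finset.univ.filter (fun x => (1 - γ) / 2 < max (1 - A x) (B x)))) := by
  have key : Finset.univ.filter (fun x => (1 - γ) / 2 < max (1 - A x) (B x)) =
      Finset.univ.filter (fun x => x ∉ cutMin A γ ∨ x ∈ cutMax B γ) := by
    ext x
    simp only [cutMin, cutMax, if_pos hγ, Finset.mem_filter, Finset.mem_univ, true_and,
      lt_max_iff, not_le]
    have : (1 - γ) / 2 < 1 - A x ↔ A x < (1 + γ) / 2 := by constructor <;> intro h <;> linarith
    rw [this]
  rw [key]
  constructor
  · refine ⟨cutMin A γ, cutMax B γ, subset_rfl, aux_cut A γ hγ, aux_cut B γ hγ, subset_rfl, ?_⟩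
    rw [aux_card]; rfl
  · rintro r ⟨S, T, h1, h2, h3, h4, rfl⟩
    rw [aux_card]
    apply aux_mono hΛ
    intro x
    simp only [Finset.mem_filter, Finset.mem_univ, true_and]
    exact Or.imp (fun h h' => h (h1 h')) (fun h => h4 h)

theorem aux_inf {X : Type*} [Fintype X] [Nonempty X]
    (Λ : ℝ → ℝ) (hΛ : IsRIM Λ) (A B : X → ℝ) (γ : ℝ) (hγ : 0 < γ) :
    IsLeast {r : ℝ | ∃ S T : Finset X, cutMin A γ ⊆ S ∧ S ⊆ cutMax A γ ∧
        cutMin B γ ⊆ T ∧ T ⊆ cutMax B γ ∧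
        Λ ((((Finset.univ \ S).card : ℝ) + ((S ∩ T).card : ℝ)) / (Fintype.card X : ℝ)) = r}
      (muLambda Λ (Finset.univ.filter (fun x => (1 + γ) / 2 ≤ max (1 - A x) (B x)))) := by
  have key : Finset.univ.filter (fun x => (1 + γ) / 2 ≤ max (1 - A x) (B x)) =
      Finset.univ.filter (fun x => x ∉ cutMax A γ ∨ x ∈ cutMin B γ) := by
    ext x
    simp only [cutMin, cutMax, if_pos hγ, Finset.mem_filter, Finset.mem_univ, true_and,
      le_max_iff, not_lt]
    have : (1 + γ) / 2 ≤ 1 - A x ↔ A x ≤ (1 - γ) / 2 := by constructor <;> intro h <;> linarith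
    rw [this]
  rw [key]
  constructor
  · refine ⟨cutMax A γ, cutMin B γ, aux_cut A γ hγ, subset_rfl, subset_rfl, aux_cut B γ hγ, ?_⟩
    rw [aux_card]; rfl
  · rintro r ⟨S, T, h1, h2, h3, h4, rfl⟩
    rw [aux_card]
    apply aux_mono hΛ
    intro x
    simp only [Finset.mem_filter, Finset.mem_univ, true_and]
    exact Or.imp (fun h h' => h (h2 h')) (fun h => h3 h)

/-- `F_owa(Q^→_Λ)(A,B)` equals the Choquet integral of `I_KD(A,B)`
w.r.t. `μ_Λ`, i.e. `F_owa(Q^→_Λ)(A,B) = Ỹ^{I_KD}_Λ(A,B)`. -/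
theorem Fowa_implicative_eq_yagerKD {X : Type*} [Fintype X] [Nonempty X]
    (Λ : ℝ → ℝ) (hΛ : IsRIM Λ) (A B : X → ℝ) (hA : IsFuzzySet A) (hB : IsFuzzySet B) :
    Fowa2 (fun S T : Finset X =>
        Λ ((((Finset.univ \ S).card : ℝ) + ((S ∩ T).card : ℝ)) / (Fintype.card X : ℝ))) A B =
      choquet (muLambda Λ) (fun x => max (1 - A x) (B x)) := by
  have hf : ∀ x, max (1 - A x) (B x) ∈ Set.Icc (0:ℝ) 1 := by
    intro x
    obtain ⟨a0, a1⟩ := hA x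
    obtain ⟨b0, b1⟩ := hB x
    exact ⟨le_max_of_le_right b0, max_le (by linarith) b1⟩
  unfold Fowa2 choquet
  set f : X → ℝ := fun x => max (1 - A x) (B x) with hfdef
  set l : List X := Finset.univ.toList.mergeSort (fun a b : X => decide (f a ≤ f b)) with hldef
  have hsort : l.Pairwise (fun a b => f a ≤ f b) := by
    have := List.pairwise_mergeSort (le := fun a b : X => decide (f a ≤ f b))
      (by intro a b c; simp only [decide_eq_true_eq]; exact le_trans)
      (by intro a b; simp only [Bool.or_eq_true, decide_eq_true_eq]; exact le_total _ _)
      Finset.univ.toList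
    simpa using this
  have huniv : l.toFinset = Finset.univ := by
    ext x
    simp [hldef]
  have hempty : muLambda Λ (∅ : Finset X) = 0 := by
    simp [muLambda, hΛ.2.1]
  have hsum : ∀ p : X → Prop, (∀ x y, p x → f x ≤ f y → p y) →
      muLambda Λ (Finset.univ.filter p) =
        ∑ i ∈ Finset.range l.length, (if p (l.getD i (Classical.arbitrary X)) then (1:ℝ) else 0) *
          (muLambda Λ (l.drop i).toFinset - muLambda Λ (l.drop (i + 1)).toFinset) := by
    intro p hp
    rw [aux_list_sum (muLambda Λ) f (Classical.arbitrary X) p hp l hsort, huniv, hempty, sub_zero]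
  have hcongr : ∀ γ ∈ Set.Ioc (0:ℝ) 1,
      (sSup {r : ℝ | ∃ S T : Finset X, cutMin A γ ⊆ S ∧ S ⊆ cutMax A γ ∧
          cutMin B γ ⊆ T ∧ T ⊆ cutMax B γ ∧
          Λ ((((Finset.univ \ S).card : ℝ) + ((S ∩ T).card : ℝ)) / (Fintype.card X : ℝ)) = r} +
       sInf {r : ℝ | ∃ S T : Finset X, cutMin A γ ⊆ S ∧ S ⊆ cutMax A γ ∧
          cutMin B γ ⊆ T ∧ T ⊆ cutMax B γ ∧
          Λ ((((Finset.univ \ S).card : ℝ) + ((S ∩ T).card : ℝ)) / (Fintype.card X : ℝ)) = r}) / 2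
      = ∑ i ∈ Finset.range l.length,
        ((muLambda Λ (l.drop i).toFinset - muLambda Λ (l.drop (i + 1)).toFinset) / 2) *
        ((if (1 - γ) / 2 < f (l.getD i (Classical.arbitrary X)) then (1:ℝ) else 0) +
        (if (1 + γ) / 2 ≤ f (l.getD i (Classical.arbitrary X)) then (1:ℝ) else 0)) := by
    intro γ hγ
    rw [(aux_sup Λ hΛ A B γ hγ.1).csSup_eq, (aux_inf Λ hΛ A B γ hγ.1).csInf_eq,
      hsum (fun x => (1 - γ) / 2 < f x) (fun x y h h' => lt_of_lt_of_le h h'),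
      hsum (fun x => (1 + γ) / 2 ≤ f x) (fun x y h h' => le_trans h h'),
      ← Finset.sum_add_distrib, Finset.sum_div]
    apply Finset.sum_congr rfl
    intro i _
    ring
  rw [intervalIntegral.integral_of_le zero_le_one,
    MeasureTheory.setIntegral_congr_fun measurableSet_Ioc hcongr,
    ← intervalIntegral.integral_of_le zero_le_one, intervalIntegral.integral_finset_sum]
  · apply Finset.sum_congr rfl
    intro i _
    rw [intervalIntegral.integral_const_mul, aux_val _ (hf _)]
    ring
  · intro i _
    exact ((aux_int1 _).add (aux_int2 _)).const_mul _
end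

section
/- For every RIM quantifier Λ, every implicator I, and all fuzzy sets A, B on X with |A|_Σ > 0, W̃^I_Λ(A,B) ≥ Ỹ²_Λ(A,B). -/
attribute [local instance] Classical.propDecidable

theorem abel_aux (g d : ℕ → ℝ) (hd : ∀ i, 0 ≤ d i) (h0 : 0 ≤ g 0) (n : ℕ)
    (hg : ∀ i, i < n → g i ≤ g (i + 1)) :
    - (g n * d (n + 1)) ≤ ∑ i ∈ Finset.range (n + 1), g i * (d i - d (i + 1)) := by
  induction n with
  | zero => simp; nlinarith [mul_nonneg h0 (hd 0)]
  | succ n ih =>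
    rw [Finset.sum_range_succ]
    have h1 := ih (fun i hi => hg i (by omega))
    have h2 := mul_nonneg (sub_nonneg.2 (hg n (by omega))) (hd (n + 1))
    nlinarith

theorem take_cons_sum_le (a : ℝ) (L : List ℝ) (h : ∀ b ∈ L, a ≤ b) (k : ℕ) (hk : k ≤ L.length) :
    ((a :: L).take k).sum ≤ (L.take k).sum := by
  cases k with
  | zero => simp
  | succ k =>
    rw [List.sum_take_succ L k (by omega), List.take_succ_cons, List.sum_cons]
    have := h (L[k]) (List.getElem_mem _)
    linarith

theorem take_sum_le_sublist {M L : List ℝ} (h : M.Sublist L) (hs : L.Pairwise (· ≤ ·)) :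
    (L.take M.length).sum ≤ M.sum := by
  induction h with
  | slnil => simp
  | cons a h ih =>
    rw [List.pairwise_cons] at hs
    exact (take_cons_sum_le a _ hs.1 _ h.length_le).trans (ih hs.2)
  | cons_cons a h ih =>
    rw [List.pairwise_cons] at hs
    simpa using ih hs.2

theorem take_sorted_le {X : Type*} [Fintype X] (A : X → ℝ) (S : Finset X) :
    (((Finset.univ.toList.map A).mergeSort (fun a b : ℝ => decide (a ≤ b))).take S.card).sum
      ≤ ∑ x ∈ S, A x := by
  have hsub : (S.toList.map A).Subperm
      ((Finset.univ.toList.map A).mergeSort (fun a b : ℝ => decide (a ≤ b))) := by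
    refine List.Subperm.trans ?_ (List.mergeSort_perm _ _).symm.subperm
    obtain ⟨N, hN, hNL⟩ : S.toList.Subperm (Finset.univ : Finset X).toList :=
      List.subperm_of_subset S.nodup_toList (fun x _ => by simp)
    exact ⟨N.map A, hN.map A, hNL.map A⟩
  obtain ⟨M, hM, hML⟩ := hsub
  have hs : ((Finset.univ.toList.map A).mergeSort (fun a b : ℝ => decide (a ≤ b))).Pairwise
      (· ≤ ·) := by
    have := List.pairwise_mergeSort (le := fun a b : ℝ => decide (a ≤ b))
      (by intro a b c; simp; exact le_trans) (by intro a b; simp; exact le_total a b)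
      (Finset.univ.toList.map A)
    simpa using this
  have h := take_sum_le_sublist hML hs
  rw [hM.length_eq, hM.sum_eq] at h
  simpa using h

theorem choquet_mono {X : Type*} [Fintype X] [Nonempty X] (μ ν : Finset X → ℝ) (f : X → ℝ)
    (hf : ∀ x, 0 ≤ f x) (h : ∀ S, ν S ≤ μ S) (h0 : ν ∅ = μ ∅) : choquet ν f ≤ choquet μ f := by
  unfold choquet
  have hs : (Finset.univ.toList.mergeSort (fun a b : X => decide (f a ≤ f b))).Pairwise
      (fun a b => f a ≤ f b) := by
    have := List.pairwise_mergeSort (le := fun a b : X => decide (f a ≤ f b))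
      (by intro a b c; simp; exact le_trans) (by intro a b; simp; exact le_total _ _)
      (Finset.univ.toList)
    simpa using this
  generalize (Finset.univ.toList.mergeSort (fun a b : X => decide (f a ≤ f b))) = l at hs
  dsimp only
  rcases hn : l.length with _ | n
  · simp
  rw [← sub_nonneg, ← Finset.sum_sub_distrib]
  have key := abel_aux (fun i => f (l.getD i (Classical.arbitrary X)))
    (fun i => μ (l.drop i).toFinset - ν (l.drop i).toFinset)
    (fun i => sub_nonneg.2 (h _)) (hf _) n (by
      intro i hi
      rw [List.getD_eq_getElem _ _ (by omega), List.getD_eq_getElem _ _ (by omega)]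
      exact List.pairwise_iff_getElem.1 hs _ _ _ _ (by omega))
  rw [List.drop_eq_nil_of_le (show l.length ≤ n + 1 by omega)] at key
  simp only [List.toFinset_nil, h0, sub_self, mul_zero, neg_zero] at key
  refine key.trans (le_of_eq (Finset.sum_congr rfl fun i _ => ?_))
  ring

/-- `W̃^I_Λ(A,B) ≥ Ỹ²_Λ(A,B)`. -/
theorem wowa_ge_ywi {X : Type*} [Fintype X] [Nonempty X]
    (Λ : ℝ → ℝ) (hΛ : IsRIM Λ) (I : ℝ → ℝ → ℝ) (hI : IsImplicator I)
    (A B : X → ℝ) (hA : IsFuzzySet A) (hB : IsFuzzySet B) (hApos : 0 < ∑ x, A x) :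
    choquet (muWeighted Λ A) (fun x => I (A x) (B x)) ≥
      choquet (muPrime Λ A) (fun x => I (A x) (B x)) := by
  obtain ⟨hmono, hz, -⟩ := hΛ
  refine choquet_mono _ _ _ (fun x => (hI.1 _ (hA x) _ (hB x)).1) (fun S => ?_) ?_
  · have hle := take_sorted_le A S
    have hSu : ∑ x ∈ S, A x ≤ ∑ x, A x :=
      Finset.sum_le_sum_of_subset_of_nonneg (Finset.subset_univ S) (fun x _ _ => (hA x).1)
    have hnn : 0 ≤ (((Finset.univ.toList.map A).mergeSort
        (fun a b : ℝ => decide (a ≤ b))).take S.card).sum := by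
      refine List.sum_nonneg fun a ha => ?_
      have h1 := List.mem_of_mem_take ha
      rw [List.mem_mergeSort, List.mem_map] at h1
      obtain ⟨x, -, rfl⟩ := h1
      exact (hA x).1
    unfold muPrime muWeighted
    refine hmono ⟨div_nonneg hnn hApos.le, ?_⟩ ⟨div_nonneg (hnn.trans hle) hApos.le, ?_⟩ ?_
    · rw [div_le_one hApos]; exact hle.trans hSu
    · rw [div_le_one hApos]; exact hSu
    · exact div_le_div_of_nonneg_right hle hApos.le
  · simp [muPrime, muWeighted]
end
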